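/- The linear Chacon map T is weakly mixing: the product transformation T × T is ergodic on (X × X, μ ⊗ μ). -/

import Mathlib

open MeasureTheory Filter Topology
open scoped symmDiff

/-- A Chacon-type rank-one map (cutting into 3, spacer sequence `s` over the middle
column), acting on a probability space `(X, μ)`. -/
structure ChaconMap {X : Type*} [MeasurableSpace X]
    (μ : Measure X) (s : ℕ → ℕ) : Type _ where
  /-- The transformation, an invertible bimeasurable map. -/
  T : X ≃ᵐ X
  measurePreserving : MeasurePreserving T μ μ
  /-- The tower heights (number of levels is `h j + 1`). -/
  h : ℕ → ℕ
  h_one : h 1 = 1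
  h_succ : ∀ j, 1 ≤ j → h (j + 1) = 3 * h j + 2 + s j
  /-- The base of the `j`-th tower. -/
  E : ℕ → Set X
  E1 : ℕ → Set X
  E2 : ℕ → Set X
  E3 : ℕ → Set X
  measE : ∀ j, MeasurableSet (E j)
  measE1 : ∀ j, MeasurableSet (E1 j)
  measE2 : ∀ j, MeasurableSet (E2 j)
  measE3 : ∀ j, MeasurableSet (E3 j)
  /-- (i) the levels of the `j`-th tower are pairwise disjoint. -/
  tower_disjoint : ∀ j, 1 ≤ j → ∀ i ≤ h j, ∀ i' ≤ h j, i ≠ i' →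
    Disjoint ((⇑T)^[i] '' E j) ((⇑T)^[i'] '' E j)
  /-- (ii) the base is cut into three pieces of equal measure. -/
  E_union : ∀ j, 1 ≤ j → E j = E1 j ∪ E2 j ∪ E3 j
  E_disj12 : ∀ j, 1 ≤ j → Disjoint (E1 j) (E2 j)
  E_disj13 : ∀ j, 1 ≤ j → Disjoint (E1 j) (E3 j)
  E_disj23 : ∀ j, 1 ≤ j → Disjoint (E2 j) (E3 j)
  E_meas12 : ∀ j, 1 ≤ j → μ (E1 j) = μ (E2 j)
  E_meas23 : ∀ j, 1 ≤ j → μ (E2 j) = μ (E3 j)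
  E_next : ∀ j, 1 ≤ j → E (j + 1) = E1 j
  /-- (iii) stacking: the top of the first column is sent to the base of the second. -/
  stack1 : ∀ j, 1 ≤ j → μ (((⇑T)^[h j + 1] '' E1 j) ∆ E2 j) = 0
  /-- (iii) stacking: the top spacer over the second column is sent to the third base. -/
  stack2 : ∀ j, 1 ≤ j → μ (((⇑T)^[h j + 1 + s j] '' E2 j) ∆ E3 j) = 0
  /-- (iii) the spacer levels are disjoint from the `j`-th tower. -/
  spacer_disjoint : ∀ j, 1 ≤ j → ∀ i, 1 ≤ i → i ≤ s j → ∀ i' ≤ h j,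
    Disjoint ((⇑T)^[h j + i] '' E2 j) ((⇑T)^[i'] '' E j)
  /-- (iv) the towers fill up the whole space. -/
  tower_full : Tendsto (fun j => μ (⋃ i ∈ Finset.range (h j + 1), (⇑T)^[i] '' E j))
    atTop (𝓝 1)
  /-- (iv) the levels of the towers generate the full σ-algebra mod `μ`. -/
  generates : ∀ A : Set X, MeasurableSet A → ∃ B : Set X,
    MeasurableSet[MeasurableSpace.generateFrom
      {S : Set X | ∃ j, 1 ≤ j ∧ ∃ i ≤ h j, S = (⇑T)^[i] '' E j}] B ∧ μ (A ∆ B) = 0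


namespace ChaconAux

/-- Approximability of `A` by unions of cells `L j i`, `i ∈ I j`, for all large `j`. -/
def Approx {Y ι : Type*} [MeasurableSpace Y] (ν : Measure Y) (L : ℕ → ι → Set Y)
    (I : ℕ → Finset ι) (A : Set Y) : Prop :=
  ∀ ε : ENNReal, 0 < ε → ∀ᶠ j in atTop, ∃ r : Finset ι, r ⊆ I j ∧ ν (A ∆ (⋃ i ∈ r, L j i)) ≤ ε

section generic
variable {Y ι : Type*} [MeasurableSpace Y] {ν : Measure Y} {L : ℕ → ι → Set Y}
    {I : ℕ → Finset ι} {A B : Set Y}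

lemma Approx.of_limit
    (h : ∀ ε : ENNReal, 0 < ε → ∃ B, Approx ν L I B ∧ ν (A ∆ B) ≤ ε) : Approx ν L I A := by
  intro ε hε
  obtain ⟨B, hB, hAB⟩ := h (ε / 2) (ENNReal.half_pos hε.ne')
  filter_upwards [hB (ε / 2) (ENNReal.half_pos hε.ne')] with j hj
  obtain ⟨r, hr, hr'⟩ := hj
  refine ⟨r, hr, (measure_symmDiff_le A B _).trans ?_⟩
  calc _ ≤ ε / 2 + ε / 2 := add_le_add hAB hr'
    _ = ε := ENNReal.add_halves ε

lemma approx_empty : Approx ν L I ∅ := by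
  intro ε hε
  exact Eventually.of_forall fun j => ⟨∅, by simp, by simp⟩

lemma Approx.union (hA : Approx ν L I A) (hB : Approx ν L I B) : Approx ν L I (A ∪ B) := by
  classical
  intro ε hε
  filter_upwards [hA (ε / 2) (ENNReal.half_pos hε.ne'), hB (ε / 2) (ENNReal.half_pos hε.ne')]
    with j h1 h2
  obtain ⟨r, hr, hr'⟩ := h1
  obtain ⟨t, ht, ht'⟩ := h2
  refine ⟨r ∪ t, Finset.union_subset hr ht, ?_⟩
  rw [Finset.set_biUnion_union]
  calc _ ≤ ν (A ∆ (⋃ i ∈ r, L j i) ∪ B ∆ (⋃ i ∈ t, L j i)) :=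
        measure_mono Set.union_symmDiff_union_subset
    _ ≤ ε / 2 + ε / 2 := (measure_union_le _ _).trans (add_le_add hr' ht')
    _ = ε := ENNReal.add_halves ε

lemma Approx.compl
    (hd : ∀ᶠ j in atTop, ∀ i ∈ I j, ∀ i' ∈ I j, i ≠ i' → Disjoint (L j i) (L j i'))
    (hfull : Tendsto (fun j => ν (⋃ i ∈ I j, L j i)ᶜ) atTop (𝓝 0))
    (hA : Approx ν L I A) : Approx ν L I Aᶜ := by
  classical
  intro ε hε
  have h2 := ENNReal.half_pos hε.ne'
  filter_upwards [hA (ε / 2) h2, hd, ENNReal.tendsto_nhds_zero.1 hfull _ h2] with j h1 hdj hf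
  obtain ⟨r, hr, hr'⟩ := h1
  refine ⟨I j \ r, Finset.sdiff_subset, ?_⟩
  calc _ ≤ ν (A ∆ (⋃ i ∈ r, L j i) ∪ (⋃ i ∈ I j, L j i)ᶜ) := by
        apply measure_mono
        intro x hx
        by_cases hxI : x ∈ ⋃ i ∈ I j, L j i
        · left
          simp only [Set.mem_iUnion, exists_prop] at hxI
          obtain ⟨i, hi, hxi⟩ := hxI
          have key : ∀ t : Finset ι, t ⊆ I j → (x ∈ ⋃ i ∈ t, L j i ↔ i ∈ t) := by
            intro t ht
            simp only [Set.mem_iUnion, exists_prop]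
            constructor
            · rintro ⟨i', hi', hxi'⟩
              by_contra hne
              have : i ≠ i' := fun h => hne (h ▸ hi')
              exact Set.disjoint_left.1 (hdj i hi i' (ht hi') this) hxi hxi'
            · exact fun h => ⟨i, h, hxi⟩
          rw [Set.mem_symmDiff, key _ Finset.sdiff_subset, Finset.mem_sdiff] at hx
          rw [Set.mem_symmDiff, key _ hr]
          simp only [Set.mem_compl_iff] at hx
          tauto
        · right; exact hxI
    _ ≤ ε / 2 + ε / 2 := (measure_union_le _ _).trans (add_le_add hr' hf)
    _ = ε := ENNReal.add_halves ε

lemma Approx.iUnion [IsFiniteMeasure ν] {A : ℕ → Set Y} (hm : ∀ n, MeasurableSet (A n))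
    (hA : ∀ n, Approx ν L I (A n)) : Approx ν L I (⋃ n, A n) := by
  apply Approx.of_limit
  intro ε hε
  have hacc : ∀ n, Approx ν L I (Set.accumulate A n) := by
    intro n
    induction n with
    | zero => simpa using hA 0
    | succ n ih => rw [Set.accumulate_succ]; exact ih.union (hA _)
  have hmacc : ∀ n, MeasurableSet (Set.accumulate A n) := fun n =>
    MeasurableSet.biUnion (Set.to_countable _) fun i _ => hm i
  have ht : Tendsto (fun n => ν (⋃ n, A n) - ν (Set.accumulate A n)) atTop (𝓝 0) := by
    have := ENNReal.Tendsto.sub (tendsto_const_nhds (x := ν (⋃ n, A n)))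
      (tendsto_measure_iUnion_accumulate (μ := ν) (f := A)) (Or.inl (measure_ne_top _ _))
    simpa using this
  obtain ⟨n, hn⟩ := (ENNReal.tendsto_nhds_zero.1 ht ε hε).exists
  refine ⟨_, hacc n, ?_⟩
  have hsub : Set.accumulate A n ⊆ ⋃ n, A n :=
    Set.iUnion₂_subset fun i _ => Set.subset_iUnion A i
  rw [Set.symmDiff_def, Set.sdiff_eq_empty.2 hsub, Set.union_empty,
    measure_sdiff hsub (hmacc n).nullMeasurableSet (measure_ne_top _ _)]
  exact hn

lemma approx_generate [IsFiniteMeasure ν] (G : Set (Set Y)) (hGm : ∀ S ∈ G, MeasurableSet S)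
    (hd : ∀ᶠ j in atTop, ∀ i ∈ I j, ∀ i' ∈ I j, i ≠ i' → Disjoint (L j i) (L j i'))
    (hfull : Tendsto (fun j => ν (⋃ i ∈ I j, L j i)ᶜ) atTop (𝓝 0))
    (hG : ∀ S ∈ G, Approx ν L I S) (S : Set Y)
    (hS : MeasurableSet[MeasurableSpace.generateFrom G] S) : Approx ν L I S := by
  have hle := MeasurableSpace.generateFrom_le hGm
  exact MeasurableSpace.generateFrom_induction G (fun S _ => Approx ν L I S)
    (fun S hS _ => hG S hS) approx_empty (fun S _ h => h.compl hd hfull)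
    (fun A hA h => Approx.iUnion (fun n => hle _ (hA n)) h) S hS

end generic

section chacon
set_option linter.unusedSectionVars false
variable {X : Type*} [MeasurableSpace X] {μ : Measure X} [IsProbabilityMeasure μ]
    {s : ℕ → ℕ} (C : ChaconMap μ s)

/-- levels of the towers -/
def lev (j i : ℕ) : Set X := (⇑C.T)^[i] '' C.E j

lemma inj (i : ℕ) : Function.Injective ((⇑C.T)^[i]) := C.T.injective.iterate i

lemma meas_image (i : ℕ) {S : Set X} (hS : MeasurableSet S) :
    MeasurableSet ((⇑C.T)^[i] '' S) := by
  induction i with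
  | zero => simpa
  | succ n ih =>
    rw [Function.iterate_succ', Set.image_comp]
    exact C.T.measurableEmbedding.measurableSet_image.2 ih

lemma measure_image (i : ℕ) {S : Set X} (hS : MeasurableSet S) :
    μ ((⇑C.T)^[i] '' S) = μ S := by
  rw [← (C.measurePreserving.iterate i).measure_preimage (meas_image C i hS).nullMeasurableSet,
    Set.preimage_image_eq _ (inj C i)]

lemma image_comm (i k : ℕ) (S : Set X) :
    (⇑C.T)^[i] '' ((⇑C.T)^[k] '' S) = (⇑C.T)^[i + k] '' S := by
  rw [Function.iterate_add, Set.image_comp]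

lemma image_ae (i : ℕ) {S S' : Set X} (hS : MeasurableSet S) (hS' : MeasurableSet S')
    (h : S =ᵐ[μ] S') : (⇑C.T)^[i] '' S =ᵐ[μ] (⇑C.T)^[i] '' S' := by
  rw [← measure_symmDiff_eq_zero_iff] at h ⊢
  rw [← Set.image_symmDiff (inj C i), measure_image C i (hS.symmDiff hS'), h]

lemma ae_E2 {j : ℕ} (hj : 1 ≤ j) : C.E2 j =ᵐ[μ] (⇑C.T)^[C.h j + 1] '' C.E1 j :=
  (measure_symmDiff_eq_zero_iff.1 (C.stack1 j hj)).symm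

lemma ae_E3 {j : ℕ} (hj : 1 ≤ j) :
    C.E3 j =ᵐ[μ] (⇑C.T)^[2 * (C.h j + 1) + s j] '' C.E1 j := by
  have h1 := (measure_symmDiff_eq_zero_iff.1 (C.stack2 j hj)).symm
  have h2 := image_ae C (C.h j + 1 + s j) (C.measE2 j) (meas_image C _ (C.measE1 j)) (ae_E2 C hj)
  rw [image_comm] at h2
  have h3 := h1.trans h2
  rwa [show C.h j + 1 + s j + (C.h j + 1) = 2 * (C.h j + 1) + s j by ring] at h3

lemma lev_split {j : ℕ} (hj : 1 ≤ j) (i : ℕ) :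
    lev C j i =ᵐ[μ] (lev C (j+1) i ∪ lev C (j+1) (i + (C.h j + 1)) ∪
      lev C (j+1) (i + (2 * (C.h j + 1) + s j)) : Set X) := by
  unfold lev
  rw [C.E_union j hj, C.E_next j hj, Set.image_union, Set.image_union]
  refine ((ae_eq_refl _).union ?_).union ?_
  · rw [← image_comm]
    exact image_ae C i (C.measE2 j) (meas_image C _ (C.measE1 j)) (ae_E2 C hj)
  · rw [← image_comm]
    exact image_ae C i (C.measE3 j) (meas_image C _ (C.measE1 j)) (ae_E3 C hj)

lemma lev_refine {j₀ : ℕ} (hj₀ : 1 ≤ j₀) {i : ℕ} (hi : i ≤ C.h j₀) (j : ℕ) (hj : j₀ ≤ j) :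
    ∃ r : Finset ℕ, r ⊆ Finset.range (C.h j + 1) ∧
      lev C j₀ i =ᵐ[μ] (⋃ a ∈ r, lev C j a) := by
  induction j, hj using Nat.le_induction with
  | base => exact ⟨{i}, by simpa using Nat.lt_succ_of_le hi, by simp; rfl⟩
  | succ j hj ih =>
    obtain ⟨r, hr, hr'⟩ := ih
    have hj1 : 1 ≤ j := hj₀.trans hj
    refine ⟨r.biUnion fun a => {a, a + (C.h j + 1), a + (2 * (C.h j + 1) + s j)}, ?_, ?_⟩
    · intro b hb
      simp only [Finset.mem_biUnion, Finset.mem_insert, Finset.mem_singleton] at hb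
      obtain ⟨a, ha, hb⟩ := hb
      have := Finset.mem_range.1 (hr ha)
      rw [Finset.mem_range, C.h_succ j hj1]
      omega
    · refine hr'.trans ?_
      rw [Finset.set_biUnion_biUnion]
      refine Filter.EventuallyEq.trans (Filter.EventuallyEq.countable_bUnion r.countable_toSet (t := fun a _ =>
        lev C (j+1) a ∪ lev C (j+1) (a + (C.h j + 1)) ∪
        lev C (j+1) (a + (2 * (C.h j + 1) + s j)))
        fun a _ => lev_split C hj1 a) (Eventually.of_forall fun x => ?_)
      simp [Set.union_assoc]

lemma tower_compl : Tendsto (fun j => μ (⋃ i ∈ Finset.range (C.h j + 1), lev C j i)ᶜ)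
    atTop (𝓝 0) := by
  have h := ENNReal.Tendsto.sub (tendsto_const_nhds (x := (1 : ENNReal))) C.tower_full
    (Or.inl ENNReal.one_ne_top)
  rw [tsub_self] at h
  refine h.congr fun j => ?_
  rw [prob_compl_eq_one_sub]
  · rfl
  · exact Finset.measurableSet_biUnion _ fun i _ => meas_image C i (C.measE j)

lemma lev_disj : ∀ᶠ j in atTop, ∀ i ∈ Finset.range (C.h j + 1), ∀ i' ∈ Finset.range (C.h j + 1),
    i ≠ i' → Disjoint (lev C j i) (lev C j i') := by
  filter_upwards [eventually_ge_atTop 1] with j hj i hi i' hi' hne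
  rw [Finset.mem_range] at hi hi'
  exact C.tower_disjoint j hj i (by omega) i' (by omega) hne

lemma approx1 {A : Set X} (hA : MeasurableSet A) :
    Approx μ (lev C) (fun j => Finset.range (C.h j + 1)) A := by
  obtain ⟨B, hB, hAB⟩ := C.generates A hA
  refine Approx.of_limit fun ε hε => ⟨B, ?_, hAB ▸ hε.le⟩
  refine approx_generate _ ?_ (lev_disj C) (tower_compl C) ?_ B hB
  · rintro S ⟨j, hj, i, hi, rfl⟩
    exact meas_image C i (C.measE j)
  · rintro S ⟨j₀, hj₀, i, hi, rfl⟩ ε hε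
    filter_upwards [eventually_ge_atTop j₀] with j hj
    obtain ⟨r, hr, h⟩ := lev_refine C hj₀ hi j hj
    exact ⟨r, hr, (measure_symmDiff_eq_zero_iff.2 h).le.trans hε.le⟩

/-- product cells -/
def lev2 (j : ℕ) (p : ℕ × ℕ) : Set (X × X) := lev C j p.1 ×ˢ lev C j p.2

/-- indices of product cells -/
def idx2 (j : ℕ) : Finset (ℕ × ℕ) := Finset.range (C.h j + 1) ×ˢ Finset.range (C.h j + 1)

lemma biUnion_lev2 (j : ℕ) (r t : Finset ℕ) :
    (⋃ p ∈ r ×ˢ t, lev2 C j p) = (⋃ i ∈ r, lev C j i) ×ˢ (⋃ i ∈ t, lev C j i) := by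
  ext ⟨x, y⟩
  simp only [lev2, Set.mem_iUnion, Finset.mem_product, Set.mem_prod, exists_prop, Prod.exists]
  constructor
  · rintro ⟨a, b, ⟨ha, hb⟩, hx, hy⟩; exact ⟨⟨a, ha, hx⟩, b, hb, hy⟩
  · rintro ⟨⟨a, ha, hx⟩, b, hb, hy⟩; exact ⟨a, b, ⟨ha, hb⟩, hx, hy⟩

lemma lev2_disj : ∀ᶠ j in atTop, ∀ i ∈ idx2 C j, ∀ i' ∈ idx2 C j,
    i ≠ i' → Disjoint (lev2 C j i) (lev2 C j i') := by
  filter_upwards [lev_disj C] with j hj i hi i' hi' hne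
  rw [idx2, Finset.mem_product] at hi hi'
  rw [lev2, lev2, Set.disjoint_prod]
  by_cases h1 : i.1 = i'.1
  · exact Or.inr (hj _ hi.2 _ hi'.2 fun h2 => hne (Prod.ext h1 h2))
  · exact Or.inl (hj _ hi.1 _ hi'.1 h1)

lemma tower2_compl : Tendsto (fun j => (μ.prod μ) (⋃ i ∈ idx2 C j, lev2 C j i)ᶜ)
    atTop (𝓝 0) := by
  have h := (tower_compl C).add (tower_compl C)
  rw [add_zero] at h
  refine tendsto_of_tendsto_of_tendsto_of_le_of_le tendsto_const_nhds h (fun _ => zero_le) ?_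
  intro j
  simp only [idx2, biUnion_lev2]
  rw [Set.compl_prod_eq_union]
  refine (measure_union_le _ _).trans ?_
  simp

lemma approx2 {A : Set (X × X)} (hA : MeasurableSet A) :
    Approx (μ.prod μ) (lev2 C) (idx2 C) A := by
  refine approx_generate (Set.image2 (fun x1 x2 => x1 ×ˢ x2) {s | MeasurableSet s}
    {t | MeasurableSet t}) ?_ (lev2_disj C) (tower2_compl C) ?_ A
    (by rw [generateFrom_prod]; exact hA)
  · rintro S ⟨B, hB, D, hD, rfl⟩
    exact hB.prod hD
  · rintro S ⟨B, hB, D, hD, rfl⟩ ε hε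
    have h2 := ENNReal.half_pos hε.ne'
    filter_upwards [approx1 C hB _ h2, approx1 C hD _ h2] with j h1 h2
    obtain ⟨r, hr, hr'⟩ := h1
    obtain ⟨t, ht, ht'⟩ := h2
    refine ⟨r ×ˢ t, Finset.product_subset_product hr ht, ?_⟩
    rw [biUnion_lev2]
    calc _ ≤ (μ.prod μ) ((B ∆ (⋃ i ∈ r, lev C j i)) ×ˢ Set.univ ∪
          Set.univ ×ˢ (D ∆ (⋃ i ∈ t, lev C j i))) := by
          apply measure_mono
          rintro ⟨x, y⟩ h
          simp only [Set.mem_symmDiff, Set.mem_prod, Set.mem_union, Set.mem_univ, and_true,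
            true_and] at h ⊢
          tauto
      _ ≤ ε / 2 + ε / 2 := by
          refine (measure_union_le _ _).trans (add_le_add ?_ ?_)
          · simpa using hr'
          · simpa using ht'
      _ = ε := ENNReal.add_halves ε

lemma iter_inv {A : Set X} (hA : ⇑C.T ⁻¹' A = A) (n : ℕ) (x : X) :
    (⇑C.T)^[n] x ∈ A ↔ x ∈ A := by
  induction n generalizing x with
  | zero => rfl
  | succ n ih =>
    rw [Function.iterate_succ_apply, ih]
    exact Set.ext_iff.1 hA x

lemma meas_lev (j i : ℕ) : MeasurableSet (lev C j i) := meas_image C i (C.measE j)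

lemma measure_inter_lev {A : Set X} (hAm : MeasurableSet A) (hA : ⇑C.T ⁻¹' A = A) (j i : ℕ) :
    μ (A ∩ lev C j i) = μ (A ∩ C.E j) := by
  rw [← measure_image C i (hAm.inter (C.measE j))]
  congr 1
  ext x
  constructor
  · rintro ⟨hx, y, hy, rfl⟩
    exact ⟨y, ⟨(iter_inv C hA i y).1 hx, hy⟩, rfl⟩
  · rintro ⟨y, ⟨hy1, hy2⟩, rfl⟩
    exact ⟨(iter_inv C hA i y).2 hy1, y, hy2, rfl⟩

lemma measure_inv_le {A : Set X} (hAm : MeasurableSet A) (hA : ⇑C.T ⁻¹' A = A) (j : ℕ) :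
    μ A ≤ (C.h j + 1 : ℕ) * μ (A ∩ C.E j) + μ (⋃ i ∈ Finset.range (C.h j + 1), lev C j i)ᶜ := by
  calc μ A ≤ μ ((⋃ i ∈ Finset.range (C.h j + 1), A ∩ lev C j i) ∪
        (⋃ i ∈ Finset.range (C.h j + 1), lev C j i)ᶜ) := by
        apply measure_mono
        intro x hx
        by_cases h : x ∈ ⋃ i ∈ Finset.range (C.h j + 1), lev C j i
        · left
          rw [← Set.inter_iUnion₂]
          exact ⟨hx, h⟩
        · exact Or.inr h
    _ ≤ _ := by
        refine (measure_union_le _ _).trans (add_le_add_left ?_ _)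
        refine (measure_biUnion_finset_le _ _).trans ?_
        simp [measure_inter_lev C hAm hA]

lemma erg : Ergodic C.T μ := by
  refine ⟨C.measurePreserving, ⟨fun A hAm hA => ?_⟩⟩
  have hAc : ⇑C.T ⁻¹' Aᶜ = Aᶜ := by rw [Set.preimage_compl, hA]
  have claim : ∀ ε : ENNReal, 0 < ε → μ A ≤ ε ∨ μ Aᶜ ≤ ε := by
    intro ε hε
    have h2 := ENNReal.half_pos hε.ne'
    obtain ⟨j, ⟨r, hr, hr'⟩, hf, hd⟩ := ((approx1 C hAm _ h2).and
      ((ENNReal.tendsto_nhds_zero.1 (tower_compl C) _ h2).and (lev_disj C))).exists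
    have hmR : MeasurableSet (⋃ i ∈ r, lev C j i) :=
      Finset.measurableSet_biUnion _ fun i _ => meas_lev C j i
    set R := ⋃ i ∈ r, lev C j i with hR
    have hmin : ∀ i ∈ Finset.range (C.h j + 1),
        min (μ (A ∩ C.E j)) (μ (Aᶜ ∩ C.E j)) ≤ μ ((A ∆ R) ∩ lev C j i) := by
      intro i hi
      by_cases hir : i ∈ r
      · refine (min_le_right _ _).trans ?_
        rw [← measure_inter_lev C hAm.compl hAc j i]
        apply measure_mono
        rintro x ⟨hx, hxi⟩
        refine ⟨Or.inr ⟨?_, hx⟩, hxi⟩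
        exact Set.mem_biUnion hir hxi
      · refine (min_le_left _ _).trans ?_
        rw [← measure_inter_lev C hAm hA j i]
        apply measure_mono
        rintro x ⟨hx, hxi⟩
        refine ⟨Or.inl ⟨hx, ?_⟩, hxi⟩
        intro hxR
        simp only [hR, Set.mem_iUnion, exists_prop] at hxR
        obtain ⟨i', hi', hxi'⟩ := hxR
        exact Set.disjoint_left.1 (hd i hi i' (hr hi') (fun h => hir (h ▸ hi'))) hxi hxi'
    have hsum : (C.h j + 1 : ℕ) * min (μ (A ∩ C.E j)) (μ (Aᶜ ∩ C.E j)) ≤ ε / 2 := by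
      refine le_trans ?_ hr'
      calc _ = ∑ i ∈ Finset.range (C.h j + 1), min (μ (A ∩ C.E j)) (μ (Aᶜ ∩ C.E j)) := by simp
        _ ≤ ∑ i ∈ Finset.range (C.h j + 1), μ ((A ∆ R) ∩ lev C j i) := Finset.sum_le_sum hmin
        _ = μ (⋃ i ∈ Finset.range (C.h j + 1), (A ∆ R) ∩ lev C j i) := by
          rw [measure_biUnion_finset]
          · intro i hi i' hi' hne
            exact (hd i hi i' hi' hne).mono Set.inter_subset_right Set.inter_subset_right
          · exact fun i _ => (hAm.symmDiff hmR).inter (meas_lev C j i)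
        _ ≤ _ := measure_mono (Set.iUnion₂_subset fun i _ => Set.inter_subset_left)
    rcases le_total (μ (A ∩ C.E j)) (μ (Aᶜ ∩ C.E j)) with h | h
    · left
      rw [min_eq_left h] at hsum
      exact (measure_inv_le C hAm hA j).trans ((add_le_add hsum hf).trans
        (ENNReal.add_halves ε).le)
    · right
      rw [min_eq_right h] at hsum
      exact (measure_inv_le C hAm.compl hAc j).trans ((add_le_add hsum hf).trans
        (ENNReal.add_halves ε).le)
  rw [eventuallyConst_set', ae_eq_empty, ae_eq_univ]
  by_contra! hcon
  obtain ⟨h1, h2⟩ := hcon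
  have hm : min (μ A) (μ Aᶜ) ≠ 0 := (lt_min (pos_iff_ne_zero.2 h1) (pos_iff_ne_zero.2 h2)).ne'
  have hmt : min (μ A) (μ Aᶜ) ≠ ⊤ := ne_top_of_le_ne_top (measure_ne_top μ A) (min_le_left _ _)
  have hlt := ENNReal.half_lt_self hm hmt
  rcases claim _ (ENNReal.half_pos hm) with h | h
  · exact absurd (hlt.trans_le (min_le_left _ _)) (not_lt.2 h)
  · exact absurd (hlt.trans_le (min_le_right _ _)) (not_lt.2 h)

lemma null_shift {S S' : Set X} (hS : MeasurableSet S) (hS' : MeasurableSet S') (k a : ℕ)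
    (h : μ (((⇑C.T)^[k] '' S) ∆ S') = 0) :
    μ {x | x ∈ (⇑C.T)^[a] '' S ∧ (⇑C.T)^[k] x ∉ (⇑C.T)^[a] '' S'} = 0 := by
  have hm : MeasurableSet (((⇑C.T)^[k] '' S) ∆ S') := (meas_image C k hS).symmDiff hS'
  have hk := (C.measurePreserving.iterate k)
  have h1 : μ ((⇑C.T)^[a] '' ((⇑C.T)^[k] ⁻¹' (((⇑C.T)^[k] '' S) ∆ S'))) = 0 := by
    rw [measure_image C a (hk.measurable hm), hk.measure_preimage hm.nullMeasurableSet, h]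
  refine measure_mono_null ?_ h1
  rintro x ⟨⟨y, hy, rfl⟩, hx⟩
  refine ⟨y, Or.inl ⟨⟨y, hy, rfl⟩, fun hy' => hx ⟨_, hy', ?_⟩⟩, rfl⟩
  rw [← Function.iterate_add_apply, ← Function.iterate_add_apply, add_comm]

lemma measure_E {j : ℕ} (hj : 1 ≤ j) : μ (C.E j) = 3 * μ (C.E1 j) := by
  rw [C.E_union j hj, measure_union ((C.E_disj13 j hj).union_left (C.E_disj23 j hj)) (C.measE3 j),
    measure_union (C.E_disj12 j hj) (C.measE2 j), ← C.E_meas23 j hj, ← C.E_meas12 j hj]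
  ring

lemma E1_sub {j : ℕ} (hj : 1 ≤ j) : C.E1 j ⊆ C.E j := by
  rw [C.E_union j hj]; exact fun x hx => Or.inl (Or.inl hx)
lemma E2_sub {j : ℕ} (hj : 1 ≤ j) : C.E2 j ⊆ C.E j := by
  rw [C.E_union j hj]; exact fun x hx => Or.inl (Or.inr hx)
lemma E3_sub {j : ℕ} (hj : 1 ≤ j) : C.E3 j ⊆ C.E j := by
  rw [C.E_union j hj]; exact fun x hx => Or.inr hx

/-- The second-coordinate shift. -/
def sh (n : ℕ) : X × X → X × X := Prod.map id ((⇑C.T)^[n])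

lemma sh_mp (n : ℕ) : MeasurePreserving (sh C n) (μ.prod μ) (μ.prod μ) :=
  (MeasurePreserving.id μ).prod (C.measurePreserving.iterate n)

lemma iter_inv2 {A : Set (X × X)} (hA : (fun x : X × X => (C.T x.1, C.T x.2)) ⁻¹' A = A)
    (n : ℕ) (x y : X) : ((⇑C.T)^[n] x, (⇑C.T)^[n] y) ∈ A ↔ (x, y) ∈ A := by
  induction n generalizing x y with
  | zero => rfl
  | succ n ih =>
    rw [Function.iterate_succ_apply, Function.iterate_succ_apply, ih]
    exact Set.ext_iff.1 hA (x, y)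

set_option maxHeartbeats 1000000 in
lemma key_bound {A : Set (X × X)} (hAm : MeasurableSet A)
    (hA : (fun x : X × X => (C.T x.1, C.T x.2)) ⁻¹' A = A) {j : ℕ} (hj : 1 ≤ j) {ε : ENNReal}
    {r : Finset (ℕ × ℕ)} (hr : r ⊆ idx2 C j)
    (hrA : (μ.prod μ) (A ∆ (⋃ p ∈ r, lev2 C j p)) ≤ ε)
    (hd : ∀ i ∈ Finset.range (C.h j + 1), ∀ i' ∈ Finset.range (C.h j + 1),
      i ≠ i' → Disjoint (lev C j i) (lev C j i'))
    (hf : μ (⋃ i ∈ Finset.range (C.h j + 1), lev C j i)ᶜ ≤ ε)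
    (he : (s j : ENNReal) * μ (C.E j) ≤ ε) :
    (μ.prod μ) (A ∆ (sh C (s j) ⁻¹' A)) ≤ 31 * ε := by
  have hmR : MeasurableSet (⋃ p ∈ r, lev2 C j p) :=
    Finset.measurableSet_biUnion _ fun p _ => (meas_lev C j _).prod (meas_lev C j _)
  have key : ∀ a ∈ Finset.range (C.h j + 1), ∀ b ∈ Finset.range (C.h j + 1), ∀ x ∈ lev C j a,
      ∀ y ∈ lev C j b, ((x, y) ∈ (⋃ p ∈ r, lev2 C j p) ↔ (a, b) ∈ r) := by
    intro a ha b hb x hx y hy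
    simp only [Set.mem_iUnion, exists_prop]
    constructor
    · rintro ⟨⟨a', b'⟩, hp, hx', hy'⟩
      have hp' := Finset.mem_product.1 (hr hp)
      have h1 : a = a' := by
        by_contra hne
        exact Set.disjoint_left.1 (hd a ha a' hp'.1 hne) hx hx'
      have h2 : b = b' := by
        by_contra hne
        exact Set.disjoint_left.1 (hd b hb b' hp'.2 hne) hy hy'
      rw [h1, h2]; exact hp
    · exact fun h => ⟨_, h, hx, hy⟩
  set R := ⋃ p ∈ r, lev2 C j p with hR
  have hmD : MeasurableSet (A ∆ R) := hAm.symmDiff hmR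
  set H := C.h j + 1 with hH
  set V := sh C (s j) with hV
  have hVmp : MeasurePreserving V (μ.prod μ) (μ.prod μ) := sh_mp C (s j)
  set G : X × X → X × X := Prod.map ((⇑C.T)^[H]) ((⇑C.T)^[H + s j]) with hG
  have hGmp : MeasurePreserving G (μ.prod μ) (μ.prod μ) :=
    (C.measurePreserving.iterate _).prod (C.measurePreserving.iterate _)
  classical
  set bad := (idx2 C j).filter fun p =>
    p.2 + s j ≤ C.h j ∧ ¬ (p ∈ r ↔ (p.1, p.2 + s j) ∈ r) with hbad
  let P : ℕ × ℕ → Set (X × X) := fun p =>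
    ((⇑C.T)^[p.1] '' C.E1 j) ×ˢ ((⇑C.T)^[p.2] '' C.E2 j)
  let N1 : ℕ → Set X := fun a =>
    {x | x ∈ (⇑C.T)^[a] '' C.E1 j ∧ (⇑C.T)^[H] x ∉ (⇑C.T)^[a] '' C.E2 j}
  let N2 : ℕ → Set X := fun a =>
    {x | x ∈ (⇑C.T)^[a] '' C.E2 j ∧ (⇑C.T)^[H + s j] x ∉ (⇑C.T)^[a] '' C.E3 j}
  have hN1 : ∀ a, μ (N1 a) = 0 := fun a =>
    null_shift C (C.measE1 j) (C.measE2 j) H a (C.stack1 j hj)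
  have hN2 : ∀ a, μ (N2 a) = 0 := fun a =>
    null_shift C (C.measE2 j) (C.measE3 j) (H + s j) a (C.stack2 j hj)
  have hshift : ∀ b y, y ∈ lev C j b → (⇑C.T)^[s j] y ∈ lev C j (b + s j) := by
    rintro b y ⟨z, hz, rfl⟩
    refine ⟨z, hz, ?_⟩
    rw [← Function.iterate_add_apply, add_comm]
  have hPsub : (⋃ p ∈ bad, P p) ⊆ (A ∆ R ∪ V ⁻¹' (A ∆ R) ∪ G ⁻¹' (A ∆ R)) ∪
      ⋃ p ∈ bad, (N1 p.1 ×ˢ Set.univ ∪ Set.univ ×ˢ N2 p.2) := by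
    rintro ⟨x, y⟩ hxy
    simp only [Set.mem_iUnion, exists_prop] at hxy
    obtain ⟨⟨a, b⟩, hp, hx, hy⟩ := hxy
    by_cases hn : (⇑C.T)^[H] x ∈ (⇑C.T)^[a] '' C.E2 j ∧ (⇑C.T)^[H + s j] y ∈ (⇑C.T)^[b] '' C.E3 j
    · left
      obtain ⟨hn1, hn2⟩ := hn
      obtain ⟨hpI, hbs, hne⟩ := Finset.mem_filter.1 hp
      obtain ⟨ha, hb⟩ := Finset.mem_product.1 hpI
      simp only at ha hb hx hy hbs
      have hx' : x ∈ lev C j a := Set.image_mono (E1_sub C hj) hx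
      have hy' : y ∈ lev C j b := Set.image_mono (E2_sub C hj) hy
      have hb' : b + s j ∈ Finset.range (C.h j + 1) := by rw [Finset.mem_range]; omega
      have e1 := key a ha b hb x hx' y hy'
      have e2 := key a ha (b + s j) hb' x hx' _ (hshift b y hy')
      have e3 := key a ha b hb _ (Set.image_mono (E2_sub C hj) hn1) _
        (Set.image_mono (E3_sub C hj) hn2)
      have e4 : ((⇑C.T)^[H] x, (⇑C.T)^[H + s j] y) ∈ A ↔ (x, (⇑C.T)^[s j] y) ∈ A := by
        rw [Function.iterate_add_apply _ H (s j) y]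
        exact iter_inv2 C hA H x _
      simp only [Set.mem_union, Set.mem_preimage, hV, sh, hG, Prod.map, id, Set.mem_symmDiff]
      simp only at hne
      tauto
    · right
      refine Set.mem_biUnion hp ?_
      rw [not_and_or] at hn
      rcases hn with hn | hn
      · exact Or.inl ⟨⟨hx, hn⟩, trivial⟩
      · exact Or.inr ⟨trivial, ⟨hy, hn⟩⟩
  have hnull : (μ.prod μ) (⋃ p ∈ bad, (N1 p.1 ×ˢ Set.univ ∪ Set.univ ×ˢ N2 p.2)) = 0 := by
    refine (measure_biUnion_null_iff bad.countable_toSet).2 ?_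
    intro p _
    refine measure_union_null ?_ ?_
    · rw [Measure.prod_prod, hN1, zero_mul]
    · rw [Measure.prod_prod, hN2, mul_zero]
  have hPle : (μ.prod μ) (⋃ p ∈ bad, P p) ≤ 3 * ε := by
    refine (measure_mono hPsub).trans ((measure_union_le _ _).trans ?_)
    rw [hnull, add_zero]
    refine (measure_union_le _ _).trans ?_
    rw [hGmp.measure_preimage hmD.nullMeasurableSet]
    refine (add_le_add_left (measure_union_le _ _) _).trans ?_
    rw [hVmp.measure_preimage hmD.nullMeasurableSet]
    calc _ ≤ ε + ε + ε := by gcongr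
      _ = 3 * ε := by ring
  have hPsum : (μ.prod μ) (⋃ p ∈ bad, P p) = bad.card * (μ (C.E1 j) * μ (C.E1 j)) := by
    rw [measure_biUnion_finset]
    · have : ∀ p, (μ.prod μ) (P p) = μ (C.E1 j) * μ (C.E1 j) := by
        intro p
        rw [Measure.prod_prod, measure_image C _ (C.measE1 j), measure_image C _ (C.measE2 j),
          ← C.E_meas12 j hj]
      simp [this]
    · intro p hp q hq hne
      have hp' := Finset.mem_product.1 (Finset.mem_filter.1 (Finset.mem_coe.1 hp)).1
      have hq' := Finset.mem_product.1 (Finset.mem_filter.1 (Finset.mem_coe.1 hq)).1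
      refine Set.disjoint_prod.2 ?_
      by_cases h1 : p.1 = q.1
      · exact Or.inr ((hd _ hp'.2 _ hq'.2 fun h2 => hne (Prod.ext h1 h2)).mono
          (Set.image_mono (E2_sub C hj)) (Set.image_mono (E2_sub C hj)))
      · exact Or.inl ((hd _ hp'.1 _ hq'.1 h1).mono
          (Set.image_mono (E1_sub C hj)) (Set.image_mono (E1_sub C hj)))
    · exact fun p _ => (meas_image C _ (C.measE1 j)).prod (meas_image C _ (C.measE2 j))
  have hbadle : (μ.prod μ) (⋃ p ∈ bad, lev2 C j p) ≤ 27 * ε := by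
    refine (measure_biUnion_finset_le _ _).trans ?_
    have : ∀ p, (μ.prod μ) (lev2 C j p) = 9 * (μ (C.E1 j) * μ (C.E1 j)) := by
      intro p
      rw [lev2, Measure.prod_prod, lev, lev, measure_image C _ (C.measE j),
        measure_image C _ (C.measE j), measure_E C hj]
      ring
    simp only [this, Finset.sum_const, nsmul_eq_mul]
    calc _ = 9 * (bad.card * (μ (C.E1 j) * μ (C.E1 j))) := by ring
      _ ≤ 9 * (3 * ε) := by rw [← hPsum]; gcongr
      _ = 27 * ε := by rw [← mul_assoc]; norm_num
  -- the top levels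
  let top := (Finset.range (C.h j + 1)).filter fun b => C.h j < b + s j
  have htop : μ (⋃ b ∈ top, lev C j b) ≤ ε := by
    refine (measure_biUnion_finset_le _ _).trans (le_trans ?_ he)
    have : ∀ p, μ (lev C j p) = μ (C.E j) := fun p => measure_image C _ (C.measE j)
    simp only [this, Finset.sum_const, nsmul_eq_mul]
    have hc : top.card ≤ s j := by
      calc top.card ≤ (Finset.Ico (C.h j + 1 - s j) (C.h j + 1)).card := by
            apply Finset.card_le_card
            intro b hb
            obtain ⟨h1, h2⟩ := Finset.mem_filter.1 hb
            rw [Finset.mem_range] at h1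
            rw [Finset.mem_Ico]
            omega
        _ ≤ s j := by rw [Nat.card_Ico]; omega
    gcongr
  have hRsub : R ∆ (V ⁻¹' R) ⊆ (⋃ p ∈ bad, lev2 C j p) ∪
      (Set.univ ×ˢ (⋃ b ∈ top, lev C j b) ∪
        Set.univ ×ˢ (⋃ i ∈ Finset.range (C.h j + 1), lev C j i)ᶜ) := by
    rintro ⟨x, y⟩ hxy
    by_cases hy : y ∈ ⋃ i ∈ Finset.range (C.h j + 1), lev C j i
    · have hx : ∃ a ∈ Finset.range (C.h j + 1), x ∈ lev C j a := by
        have : ∃ y', (x, y') ∈ R := by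
          rcases hxy with h | h
          · exact ⟨_, h.1⟩
          · exact ⟨_, h.1⟩
        obtain ⟨y', hy'⟩ := this
        simp only [hR, Set.mem_iUnion, exists_prop] at hy'
        obtain ⟨p, hp, hp'⟩ := hy'
        exact ⟨p.1, (Finset.mem_product.1 (hr hp)).1, hp'.1⟩
      obtain ⟨a, ha, hxa⟩ := hx
      simp only [Set.mem_iUnion, exists_prop] at hy
      obtain ⟨b, hb, hyb⟩ := hy
      by_cases hbs : b + s j ≤ C.h j
      · left
        have hb' : b + s j ∈ Finset.range (C.h j + 1) := by rw [Finset.mem_range]; omega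
        have e1 := key a ha b hb x hxa y hyb
        have e2 := key a ha (b + s j) hb' x hxa _ (hshift b y hyb)
        have hxy' : ¬ ((a, b) ∈ r ↔ (a, b + s j) ∈ r) := by
          simp only [Set.mem_preimage, hV, sh, Prod.map, id, Set.mem_symmDiff] at hxy
          tauto
        have hmem : (a, b) ∈ bad :=
          Finset.mem_filter.2 ⟨Finset.mem_product.2 ⟨ha, hb⟩, hbs, hxy'⟩
        exact Set.mem_biUnion hmem ⟨hxa, hyb⟩
      · right; left
        refine ⟨trivial, ?_⟩
        have hmem : b ∈ top := Finset.mem_filter.2 ⟨hb, by omega⟩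
        exact Set.mem_biUnion hmem hyb
    · right; right
      exact ⟨trivial, hy⟩
  have hRle : (μ.prod μ) (R ∆ (V ⁻¹' R)) ≤ 27 * ε + (ε + ε) := by
    refine (measure_mono hRsub).trans ((measure_union_le _ _).trans (add_le_add hbadle ?_))
    refine (measure_union_le _ _).trans (add_le_add ?_ ?_)
    · rw [Measure.prod_prod, measure_univ, one_mul]; exact htop
    · rw [Measure.prod_prod, measure_univ, one_mul]; exact hf
  have hVle : (μ.prod μ) ((V ⁻¹' R) ∆ (V ⁻¹' A)) ≤ ε := by
    rw [← Set.preimage_symmDiff, hVmp.measure_preimage (hmR.symmDiff hAm).nullMeasurableSet,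
      symmDiff_comm]
    exact hrA
  calc _ ≤ (μ.prod μ) (A ∆ R) + (μ.prod μ) (R ∆ (V ⁻¹' A)) := measure_symmDiff_le _ _ _
    _ ≤ (μ.prod μ) (A ∆ R) + ((μ.prod μ) (R ∆ (V ⁻¹' R)) + (μ.prod μ) ((V ⁻¹' R) ∆ (V ⁻¹' A))) := by
      gcongr; exact measure_symmDiff_le _ _ _
    _ ≤ ε + ((27 * ε + (ε + ε)) + ε) := by gcongr
    _ = 31 * ε := by ring

lemma key_tendsto {A : Set (X × X)} (hAm : MeasurableSet A)
    (hA : (fun x : X × X => (C.T x.1, C.T x.2)) ⁻¹' A = A)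
    (hs : Tendsto (fun j => (s j : ENNReal) * μ (C.E j)) atTop (𝓝 0)) :
    Tendsto (fun j => (μ.prod μ) (A ∆ (sh C (s j) ⁻¹' A))) atTop (𝓝 0) := by
  rw [ENNReal.tendsto_nhds_zero]
  intro ε hε
  have hε' : 0 < ε / 31 := ENNReal.div_pos hε.ne' (by norm_num)
  filter_upwards [approx2 C hAm _ hε', lev_disj C, eventually_ge_atTop 1,
    ENNReal.tendsto_nhds_zero.1 (tower_compl C) _ hε', ENNReal.tendsto_nhds_zero.1 hs _ hε']
    with j h1 h2 h3 h4 h5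
  obtain ⟨r, hr, hrA⟩ := h1
  refine (key_bound C hAm hA h3 hr hrA h2 h4 h5).trans ?_
  rw [ENNReal.mul_div_cancel (by norm_num) (by norm_num)]

end chacon

section linear
variable {X : Type*} [MeasurableSpace X] {μ : Measure X} [IsProbabilityMeasure μ]
    (C : ChaconMap μ (fun j => j))

lemma measure_E_pow (j : ℕ) : μ (C.E (j + 1)) ≤ (1 / 3) ^ j := by
  induction j with
  | zero => simpa using prob_le_one
  | succ j ih =>
    have h := measure_E C (j := j + 1) (by omega)
    rw [← C.E_next (j + 1) (by omega)] at h
    have h2 : μ (C.E (j + 1 + 1)) = 1 / 3 * μ (C.E (j + 1)) := by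
      rw [h, ← mul_assoc, one_div, ENNReal.inv_mul_cancel (by norm_num) (by norm_num), one_mul]
    rw [h2, pow_succ, mul_comm]
    gcongr

lemma tendsto_top_levels : Tendsto (fun j : ℕ => (j : ENNReal) * μ (C.E j)) atTop (𝓝 0) := by
  rw [← tendsto_add_atTop_iff_nat 1]
  have h0 : Tendsto (fun n : ℕ => ((n : ℝ) * (1 / 3) ^ n + (1 / 3) ^ n)) atTop (𝓝 0) := by
    have h1 := tendsto_self_mul_const_pow_of_lt_one (r := 1 / 3) (by norm_num) (by norm_num)
    have h2 := tendsto_pow_atTop_nhds_zero_of_lt_one (r := (1 / 3 : ℝ)) (by norm_num) (by norm_num)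
    simpa using h1.add h2
  have h3 := ENNReal.tendsto_ofReal h0
  rw [ENNReal.ofReal_zero] at h3
  refine tendsto_of_tendsto_of_tendsto_of_le_of_le tendsto_const_nhds h3 (fun _ => zero_le) ?_
  intro j
  have : ENNReal.ofReal ((j : ℝ) * (1 / 3) ^ j + (1 / 3) ^ j) = ((j + 1 : ℕ) : ENNReal) * (1 / 3) ^ j := by
    rw [show (j : ℝ) * (1 / 3) ^ j + (1 / 3) ^ j = ((j + 1 : ℕ) : ℝ) * (1 / 3) ^ j by
      push_cast; ring, ENNReal.ofReal_mul (by positivity), ENNReal.ofReal_natCast,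
      ENNReal.ofReal_pow (by norm_num), ENNReal.ofReal_div_of_pos (by norm_num)]
    simp
  simp only [this]
  gcongr
  exact measure_E_pow C j

lemma sh_inv {A : Set (X × X)} (hAm : MeasurableSet A)
    (hA : (fun x : X × X => (C.T x.1, C.T x.2)) ⁻¹' A = A) :
    sh C 1 ⁻¹' A =ᵐ[μ.prod μ] A := by
  have ht := key_tendsto C hAm hA (tendsto_top_levels C)
  have ht2 := (tendsto_add_atTop_iff_nat 1).2 ht
  have ht3 := ht.add ht2
  rw [add_zero] at ht3
  rw [← measure_symmDiff_eq_zero_iff]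
  refine le_antisymm (ge_of_tendsto ht3 (Eventually.of_forall fun j => ?_)) zero_le
  have hm : MeasurableSet ((sh C 1 ⁻¹' A) ∆ A) := ((sh_mp C 1).measurable hAm).symmDiff hAm
  rw [← (sh_mp C j).measure_preimage hm.nullMeasurableSet, Set.preimage_symmDiff]
  have e : sh C j ⁻¹' (sh C 1 ⁻¹' A) = sh C (j + 1) ⁻¹' A := by
    ext ⟨x, y⟩
    simp only [sh, Set.mem_preimage, Prod.map, id, Function.iterate_succ_apply',
      Function.iterate_zero_apply]
  rw [e]
  refine (measure_symmDiff_le _ A _).trans (le_of_eq ?_)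
  rw [symmDiff_comm (sh C (j + 1) ⁻¹' A) A, add_comm]

theorem main : Ergodic (fun x : X × X => (C.T x.1, C.T x.2)) (μ.prod μ) := by
  refine ⟨C.measurePreserving.prod C.measurePreserving, ⟨fun A hAm hA => ?_⟩⟩
  have hsh := sh_inv C hAm hA
  have hfib : ∀ᵐ x ∂μ, μ (Prod.mk x ⁻¹' A) = 0 ∨ μ (Prod.mk x ⁻¹' A)ᶜ = 0 := by
    have h1 : ∀ᵐ z ∂(μ.prod μ), (sh C 1 z ∈ A ↔ z ∈ A) := eventuallyEq_set.1 hsh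
    filter_upwards [Measure.ae_ae_of_ae_prod h1] with x hx
    rw [← ae_eq_empty, ← ae_eq_univ]
    refine (erg C).quasiErgodic.ae_empty_or_univ₀
      (measurable_prodMk_left hAm).nullMeasurableSet (eventuallyEq_set.2 ?_)
    filter_upwards [hx] with y hy
    exact hy
  have hg : ∀ x, μ (Prod.mk (C.T x) ⁻¹' A) = μ (Prod.mk x ⁻¹' A) := by
    intro x
    rw [← C.measurePreserving.measure_preimage (measurable_prodMk_left hAm).nullMeasurableSet]
    congr 1
    ext y
    exact Set.ext_iff.1 hA (x, y)
  have hBm : MeasurableSet {x | μ (Prod.mk x ⁻¹' A) = 0} :=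
    measurable_measure_prodMk_left hAm (measurableSet_singleton 0)
  have hB := (erg C).quasiErgodic.ae_empty_or_univ₀ hBm.nullMeasurableSet
    (Filter.EventuallyEq.of_eq (by ext x; simp [hg]))
  rw [eventuallyConst_set', ae_eq_empty, ae_eq_univ]
  rcases hB with hB | hB
  · right
    rw [Measure.measure_prod_null hAm.compl]
    filter_upwards [hfib, eventuallyEq_set.1 hB] with x hx hx'
    simp only [Set.mem_empty_iff_false, iff_false] at hx'
    change ¬ (μ (Prod.mk x ⁻¹' A) = 0) at hx'
    simpa [hx'] using hx
  · left
    rw [Measure.measure_prod_null hAm]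
    filter_upwards [eventuallyEq_set.1 hB] with x hx'
    simpa using hx'

end linear
end ChaconAux

/-- the linear Chacon map is weakly mixing: `T × T` is ergodic for
`μ ⊗ μ`. -/
theorem linearChacon_weaklyMixing
    {X : Type*} [MeasurableSpace X] (μ : Measure X) [IsProbabilityMeasure μ]
    (C : ChaconMap μ (fun j => j)) :
    Ergodic (fun x : X × X => (C.T x.1, C.T x.2)) (μ.prod μ) := by
  exact ChaconAux.main C
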